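/- Suppose $\frac{\nu\, \mathbb{E}^\mu[C]}{1 - \mathbb{E}^q[H(a)]} < \rho < \frac{\nu(x_c - 1)}{\theta_c}$. Then there exists a unique $\theta^\dagger \in (0, \theta_c)$ such that $\Gamma_C(\theta^\dagger) = \rho\, \theta^\dagger$, where $\Gamma_C(\theta) = \nu(x(\theta) - 1)$ and $x(\theta)$ is the minimal solution of $x = \int_{\mathbb{R}^+} \int_{\mathbb{X}} e^{\theta C + (x-1)H(a)} q(da)\, \mu(dC)$. -/

import Mathlib

open MeasureTheory Filter Set

/-- Strict monotonicity of the integral. -/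
lemma aux_lt {Ω : Type*} [MeasurableSpace Ω] (P : Measure Ω) (f g : Ω → ℝ)
    (hf : Integrable f P) (hg : Integrable g P) (hle : f ≤ᵐ[P] g) (hne : ¬ f =ᵐ[P] g) :
    ∫ p, f p ∂P < ∫ p, g p ∂P := by
  refine lt_of_le_of_ne (integral_mono_ae hf hg hle) ?_
  intro h
  exact hne ((integral_eq_iff_of_ae_le hf hg hle).1 h)

/-- Convexity of the integral of the exponential. -/
lemma aux_convex {Ω : Type*} [MeasurableSpace Ω] (P : Measure Ω) (U V W : Ω → ℝ)
    (hU : Integrable (fun p => Real.exp (U p)) P) (hV : Integrable (fun p => Real.exp (V p)) P)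
    (hW : Integrable (fun p => Real.exp (W p)) P)
    (a b : ℝ) (ha : 0 ≤ a) (hb : 0 ≤ b) (hab : a + b = 1) (h : ∀ p, W p = a * U p + b * V p) :
    ∫ p, Real.exp (W p) ∂P ≤ a * ∫ p, Real.exp (U p) ∂P + b * ∫ p, Real.exp (V p) ∂P := by
  rw [← integral_const_mul, ← integral_const_mul,
    ← integral_add (hU.const_mul a) (hV.const_mul b)]
  refine integral_mono hW ((hU.const_mul a).add (hV.const_mul b)) ?_
  intro p
  have := convexOn_exp.2 (mem_univ (U p)) (mem_univ (V p)) ha hb hab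
  simpa [h p, smul_eq_mul] using this

/-- under the net profit / non-triviality condition
`ν E^μ[C]/(1 - E^q[H]) < ρ < ν(x_c - 1)/θ_c`, there is a unique
`θ† ∈ (0, θ_c)` with `Γ_C(θ†) = ρ θ†`, where `Γ_C(θ) = ν (x(θ) - 1)` and `x(θ)` is
the minimal solution of `x = ∫∫ e^{θ C + (x-1) H(a)} q(da) μ(dC)`. -/
theorem stmt_12 {X : Type*} [MeasurableSpace X] (q : Measure X) [IsProbabilityMeasure q]
    (H : X → ℝ) (hHmeas : Measurable H) (hHnonneg : ∀ a, 0 ≤ H a)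
    (hHmean : ∫ a, H a ∂q < 1)
    (μ : Measure ℝ) [IsProbabilityMeasure μ] (hμpos : ∀ᵐ C ∂μ, 0 < C)
    (hCint : Integrable (fun C : ℝ => C) μ)
    (hint : ∀ θ x : ℝ,
      Integrable (fun p : ℝ × X => Real.exp (θ * p.1 + (x - 1) * H p.2)) (μ.prod q))
    (ν ρ : ℝ) (hν : 0 < ν) (hρ : 0 < ρ)
    (xc θc : ℝ) (hxc : 1 < xc) (hθc : 0 < θc)
    (hc1 : xc = ∫ C, ∫ a, Real.exp (θc * C + H a * (xc - 1)) ∂q ∂μ)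
    (hc2 : 1 = ∫ C, ∫ a, H a * Real.exp (H a * (xc - 1) + θc * C) ∂q ∂μ)
    (xfun : ℝ → ℝ)
    (hxfun : ∀ θ ≤ θc,
      IsLeast {x : ℝ | 0 ≤ x ∧
        x = ∫ C, ∫ a, Real.exp (θ * C + (x - 1) * H a) ∂q ∂μ} (xfun θ))
    (hρ1 : ν * (∫ C, C ∂μ) / (1 - ∫ a, H a ∂q) < ρ)
    (hρ2 : ρ < ν * (xc - 1) / θc) :
    ∃! θd : ℝ, θd ∈ Ioo 0 θc ∧ ν * (xfun θd - 1) = ρ * θd := by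
  set P := μ.prod q with hP
  set F : ℝ → ℝ → ℝ := fun θ x => ∫ p, Real.exp (θ * p.1 + (x - 1) * H p.2) ∂P with hF
  have hFeq : ∀ θ x, ∫ C, ∫ a, Real.exp (θ * C + (x - 1) * H a) ∂q ∂μ = F θ x := by
    intro θ x
    rw [hF]
    exact (integral_prod _ (hint θ x)).symm
  have hCpos : ∀ᵐ p ∂P, 0 < p.1 := Measure.quasiMeasurePreserving_fst.ae hμpos
  have hHm : Measurable (fun p : ℝ × X => H p.2) := hHmeas.comp measurable_snd
  -- integrability of `H e^{...}`
  have hHexp : ∀ θ x : ℝ,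
      Integrable (fun p : ℝ × X => H p.2 * Real.exp (θ * p.1 + (x - 1) * H p.2)) P := by
    intro θ x
    refine (hint θ (x + 1)).mono' ?_ ?_
    · exact (hHm.mul (Real.measurable_exp.comp
        ((measurable_fst.const_mul θ).add (hHm.const_mul (x - 1))))).aestronglyMeasurable
    · refine Eventually.of_forall fun p => ?_
      rw [Real.norm_of_nonneg (mul_nonneg (hHnonneg _) (Real.exp_pos _).le)]
      have h1 : H p.2 ≤ Real.exp (H p.2) := by linarith [Real.add_one_le_exp (H p.2)]
      calc H p.2 * Real.exp (θ * p.1 + (x - 1) * H p.2)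
          ≤ Real.exp (H p.2) * Real.exp (θ * p.1 + (x - 1) * H p.2) := by gcongr
        _ = Real.exp (θ * p.1 + (x + 1 - 1) * H p.2) := by
          rw [← Real.exp_add]; congr 1; ring
  have hHintP : Integrable (fun p : ℝ × X => H p.2) P := by
    simpa using hHexp 0 1
  have hCintP : Integrable (fun p : ℝ × X => p.1) P := hCint.comp_fst q
  have hEC : ∫ p, p.1 ∂P = ∫ C, C ∂μ := by
    rw [hP, integral_prod _ hCintP]; simp
  have hEH : ∫ p, H p.2 ∂P = ∫ a, H a ∂q := by
    rw [hP, integral_prod _ hHintP]; simp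
  have hc1' : F θc xc = xc := by
    rw [← hFeq]
    conv_rhs => rw [hc1]
    simp only [mul_comm (xc - 1)]
  have hc2' : ∫ p, H p.2 * Real.exp (θc * p.1 + (xc - 1) * H p.2) ∂P = 1 := by
    rw [hP, integral_prod _ (hHexp θc xc)]
    refine Eq.trans ?_ hc2.symm
    refine integral_congr_ae (Eventually.of_forall fun C => ?_)
    refine integral_congr_ae (Eventually.of_forall fun a => ?_)
    simp only
    congr 2
    ring
  -- the slope
  set k : ℝ := ρ / ν with hk
  have hkν : k * ν = ρ := by rw [hk]; field_simp
  have hkpos : 0 < k := div_pos hρ hν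
  have hk1 : ∫ C, C ∂μ < k * (1 - ∫ a, H a ∂q) := by
    rw [div_lt_iff₀ (by linarith)] at hρ1
    rw [← hkν] at hρ1
    nlinarith
  have hk2 : k * θc < xc - 1 := by
    rw [lt_div_iff₀ hθc, ← hkν] at hρ2
    nlinarith
  set Y : ℝ × X → ℝ := fun p => p.1 + k * H p.2 with hY
  have hYe : ∀ t : ℝ, ∀ p : ℝ × X, t * Y p = t * p.1 + ((1 + k * t) - 1) * H p.2 := by
    intro t p; simp only [hY]; ring
  have hYint : ∀ t : ℝ, Integrable (fun p => Real.exp (t * Y p)) P := by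
    intro t
    simp only [hYe]
    exact hint t (1 + k * t)
  have hmgf : ∀ t, ProbabilityTheory.mgf Y P t = F t (1 + k * t) := by
    intro t
    simp only [ProbabilityTheory.mgf, hF, hYe]
  have hset : ProbabilityTheory.integrableExpSet Y P = univ := by
    ext t
    simpa [ProbabilityTheory.integrableExpSet] using hYint t
  set g : ℝ → ℝ := fun t => ProbabilityTheory.mgf Y P t - 1 - k * t with hg
  have hgF : ∀ t, g t = F t (1 + k * t) - (1 + k * t) := by
    intro t; simp only [hg, hmgf]; ring
  have hder : ∀ t, HasDerivAt g (∫ p, Y p * Real.exp (t * Y p) ∂P - k) t := by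
    intro t
    have h1 := ProbabilityTheory.hasDerivAt_mgf (X := Y) (μ := P) (t := t) (by rw [hset]; simp)
    have h2 := (h1.sub_const 1).sub ((hasDerivAt_id t).const_mul k)
    rw [mul_one] at h2
    exact h2
  have hgcont : Continuous g :=
    continuous_iff_continuousAt.2 fun t => (hder t).continuousAt
  have hg0 : g 0 = 0 := by simp [hg]
  have hder0 : ∫ p, Y p * Real.exp (0 * Y p) ∂P - k < 0 := by
    have : ∫ p, Y p * Real.exp (0 * Y p) ∂P = ∫ C, C ∂μ + k * ∫ a, H a ∂q := by
      simp only [zero_mul, Real.exp_zero, mul_one, hY]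
      rw [integral_add hCintP (hHintP.const_mul k), integral_const_mul, hEC, hEH]
    rw [this]; nlinarith
  have hneg : ∀ s > 0, ∃ t, 0 < t ∧ t < s ∧ g t < 0 := by
    intro s hs
    have h1 := (hasDerivAt_iff_tendsto_slope.1 (hder 0)).eventually (gt_mem_nhds hder0)
    have h2 : ∀ᶠ t in nhdsWithin (0:ℝ) (Ioi 0), slope g 0 t < 0 :=
      h1.filter_mono (nhdsWithin_mono _ (fun t ht => ne_of_gt ht))
    obtain ⟨t, ht1, ht2⟩ := (h2.and (Ioo_mem_nhdsGT hs)).exists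
    refine ⟨t, ht2.1, ht2.2, ?_⟩
    rw [slope_def_field, hg0, sub_zero, sub_zero, div_neg_iff] at ht1
    rcases ht1 with h | h
    · linarith [h.2, ht2.1]
    · exact h.1
  have hgconv : ∀ t₁ t₂ a b : ℝ, 0 ≤ a → 0 ≤ b → a + b = 1 →
      g (a * t₁ + b * t₂) ≤ a * g t₁ + b * g t₂ := by
    intro t₁ t₂ a b ha hb hab
    have := aux_convex P (fun p => t₁ * Y p) (fun p => t₂ * Y p)
      (fun p => (a * t₁ + b * t₂) * Y p) (hYint _) (hYint _) (hYint _) a b ha hb hab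
      (fun p => by ring)
    simp only [hg, ProbabilityTheory.mgf]
    have hb' : b = 1 - a := by linarith
    subst hb'
    linarith
  -- positivity at the critical value
  have hgc : 0 < g θc := by
    rw [hgF]
    set x := 1 + k * θc with hx
    have hxlt : x < xc := by linarith
    have hI : Integrable (fun p : ℝ × X => Real.exp (θc * p.1 + (xc - 1) * H p.2)
        + (x - xc) * (H p.2 * Real.exp (θc * p.1 + (xc - 1) * H p.2))) P :=
      (hint θc xc).add ((hHexp θc xc).const_mul _)
    have hv : ∫ p, (Real.exp (θc * p.1 + (xc - 1) * H p.2)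
        + (x - xc) * (H p.2 * Real.exp (θc * p.1 + (xc - 1) * H p.2))) ∂P = x := by
      rw [integral_add (hint θc xc) ((hHexp θc xc).const_mul _), integral_const_mul, hc2']
      have : ∫ p, Real.exp (θc * p.1 + (xc - 1) * H p.2) ∂P = xc := hc1'
      rw [this]; ring
    have hfac : ∀ p : ℝ × X, Real.exp (θc * p.1 + (x - 1) * H p.2)
        = Real.exp (θc * p.1 + (xc - 1) * H p.2) * Real.exp ((x - xc) * H p.2) := by
      intro p; rw [← Real.exp_add]; congr 1; ring
    have hlt := aux_lt P _ _ hI (hint θc x) (Eventually.of_forall fun p => by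
      simp only
      rw [hfac]
      have := mul_le_mul_of_nonneg_left (Real.add_one_le_exp ((x - xc) * H p.2))
        (Real.exp_pos (θc * p.1 + (xc - 1) * H p.2)).le
      linarith) (by
      intro heq
      have hz : ∀ᵐ p ∂P, H p.2 * Real.exp (θc * p.1 + (xc - 1) * H p.2) = 0 := by
        filter_upwards [heq] with p hp
        rw [hfac] at hp
        by_contra hne
        have hH : H p.2 ≠ 0 := fun h => hne (by rw [h, zero_mul])
        have := mul_lt_mul_of_pos_left
          (Real.add_one_lt_exp (mul_ne_zero (sub_ne_zero.2 hxlt.ne) hH))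
          (Real.exp_pos (θc * p.1 + (xc - 1) * H p.2))
        linarith
      rw [integral_congr_ae hz] at hc2'
      simp at hc2')
    rw [hv] at hlt
    have : x < F θc x := hlt
    linarith
  have hback : ∀ θ ∈ Ioo 0 θc, ν * (xfun θ - 1) = ρ * θ → xfun θ = 1 + k * θ := by
    intro θ hθ h
    rw [← hkν] at h
    have h2 : ν * (xfun θ - 1 - k * θ) = 0 := by linarith
    rcases mul_eq_zero.1 h2 with h3 | h3
    · exact absurd h3 hν.ne'
    · linarith
  have hzero : ∀ θ ∈ Ioo 0 θc, ν * (xfun θ - 1) = ρ * θ → g θ = 0 := by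
    intro θ hθ h
    have h1 := (hxfun θ hθ.2.le).1.2
    rw [hFeq, hback θ hθ h] at h1
    rw [hgF]; linarith
  have huniq : ∀ s ∈ Ioo 0 θc, ∀ t ∈ Ioo 0 θc, g s = 0 → g t = 0 → ¬ s < t := by
    intro s hs t ht hgs hgt hst
    obtain ⟨r, hr0, hrs, hgr⟩ := hneg s hs.1
    have hd : 0 < t - r := by linarith
    have h := hgconv r t ((t - s) / (t - r)) ((s - r) / (t - r))
      (div_nonneg (by linarith) hd.le) (div_nonneg (by linarith) hd.le)
      (by field_simp; ring)
    have he : (t - s) / (t - r) * r + (s - r) / (t - r) * t = s := by field_simp; ring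
    rw [he, hgs, hgt, mul_zero, add_zero] at h
    have : (t - s) / (t - r) * g r < 0 := mul_neg_of_pos_of_neg (div_pos (by linarith) hd) hgr
    linarith
  obtain ⟨t0, ht0, ht0c, hgt0⟩ := hneg θc hθc
  obtain ⟨θd, hθd, hgd⟩ := intermediate_value_Ioo ht0c.le hgcont.continuousOn
    (show (0:ℝ) ∈ Ioo (g t0) (g θc) from ⟨hgt0, hgc⟩)
  have hθd' : θd ∈ Ioo 0 θc := ⟨ht0.trans hθd.1, hθd.2⟩
  refine ⟨θd, ⟨hθd', ?_⟩, ?_⟩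
  · have hleast := hxfun θd hθd'.2.le
    set z := 1 + k * θd with hz
    have hFz : F θd z = z := by have := hgF θd; linarith
    have hz0 : 0 ≤ z := by have := mul_pos hkpos hθd'.1; linarith
    have hyz : xfun θd ≤ z := hleast.2 ⟨hz0, by rw [hFeq, hFz]⟩
    have hy : F θd (xfun θd) = xfun θd := by
      rw [← hFeq]; exact hleast.1.2.symm
    have hzc : z < xc := by
      have := mul_lt_mul_of_pos_left hθd'.2 hkpos
      linarith
    have hxz : xfun θd = z := by
      by_contra hne
      have hlt : xfun θd < z := lt_of_le_of_ne hyz hne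
      set y := xfun θd with hydef
      have hstrict : F θd xc < xc := by
        conv_rhs => rw [← hc1']
        refine aux_lt P _ _ (hint θd xc) (hint θc xc) ?_ ?_
        · filter_upwards [hCpos] with p hp
          have := mul_lt_mul_of_pos_right hθd'.2 hp
          exact Real.exp_le_exp.2 (by linarith)
        · intro heq
          have hfalse : ∀ᵐ p ∂P, False := by
            filter_upwards [hCpos, heq] with p hp hpe
            have := mul_lt_mul_of_pos_right hθd'.2 hp
            have := Real.exp_injective hpe
            linarith
          obtain ⟨p, hp⟩ := hfalse.exists
          exact hp
      have hd : 0 < xc - y := by linarith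
      have h := aux_convex P (fun p => θd * p.1 + (y - 1) * H p.2)
        (fun p => θd * p.1 + (xc - 1) * H p.2) (fun p => θd * p.1 + (z - 1) * H p.2)
        (hint _ _) (hint _ _) (hint _ _) ((xc - z) / (xc - y)) ((z - y) / (xc - y))
        (div_nonneg (by linarith) hd.le) (div_nonneg (by linarith) hd.le)
        (by field_simp; ring) (fun p => by field_simp; ring)
      change F θd z ≤ _ * F θd y + _ * F θd xc at h
      rw [hFz, hy] at h
      have h3 := mul_lt_mul_of_pos_left hstrict (div_pos (sub_pos.2 hlt) hd)
      have h4 : (xc - z) / (xc - y) * y + (z - y) / (xc - y) * xc = z := by field_simp; ring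
      linarith
    rw [hxz, hz, ← hkν]; ring
  · rintro θ ⟨hθ, hθe⟩
    have h0 := hzero θ hθ hθe
    exact le_antisymm (not_lt.1 (huniq θd hθd' θ hθ hgd h0))
      (not_lt.1 (huniq θ hθ θd hθd' h0 hgd))
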